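/- arXiv:2404.06013 — 7 statements merged into one kernel-verified Lean document; each statement's English description precedes it below -/
import Mathlib

section
/- Let B > 0 and let σ(z) = log(1 + exp(-z)). For every η ∈ (0, 1) and all p, q ∈ [-2B, 2B], one has σ((1-η)p + ηq) - (1-η)σ(p) - ησ(q) ≤ -(e^{-2B}/8) · η(1-η) · (q - p)². -/
open Real

theorem hasDerivAt_logistic (z : ℝ) :
    HasDerivAt (fun z => log (1 + exp (-z))) (-exp (-z) / (1 + exp (-z))) z := by
  have hexp : HasDerivAt (fun z : ℝ => 1 + exp (-z)) (-exp (-z)) z := by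
    simpa using ((hasDerivAt_neg z).exp).const_add 1
  exact hexp.log (by positivity)

theorem hasDerivAt_deriv_logistic (z : ℝ) :
    HasDerivAt (fun z => -exp (-z) / (1 + exp (-z))) (exp (-z) / (1 + exp (-z)) ^ 2) z := by
  have hexp : HasDerivAt (fun z : ℝ => exp (-z)) (-exp (-z)) z := by
    simpa using (hasDerivAt_neg z).exp
  have hne : 1 + exp (-z) ≠ 0 := by positivity
  refine (hexp.fun_neg.fun_div (hexp.const_add 1) hne).congr_deriv ?_
  congr 1
  ring

theorem exp_neg_div_four_le_deriv2_logistic {r z : ℝ} (hz : z ∈ Set.Icc (-r) r) :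
    exp (-r) / 4 ≤ exp (-z) / (1 + exp (-z)) ^ 2 := by
  rw [div_le_div_iff₀ (by norm_num) (by positivity)]
  have h₁ : exp (-r) ≤ exp (-z) := exp_le_exp.2 (neg_le_neg hz.2)
  have h₂ : exp (-r) * exp (-z) ≤ 1 := by
    rw [← exp_add]
    exact exp_le_one_iff.2 (by linarith [hz.1])
  have h₃ : exp (-r) ≤ 1 := exp_le_one_iff.2 (by linarith [hz.1, hz.2])
  nlinarith [exp_pos (-z)]

theorem strongConvexOn_logistic (r : ℝ) :
    StrongConvexOn (Set.Icc (-r) r) (exp (-r) / 4) fun z => log (1 + exp (-z)) := by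
  rw [strongConvexOn_iff_convex]
  have hderiv (z : ℝ) : HasDerivAt
      (fun z => log (1 + exp (-z)) - exp (-r) / 4 / 2 * ‖z‖ ^ 2)
      (-exp (-z) / (1 + exp (-z)) - exp (-r) / 4 * z) z := by
    simp only [norm_eq_abs, sq_abs]
    refine ((hasDerivAt_logistic z).fun_sub
      ((hasDerivAt_pow 2 z).const_mul (exp (-r) / 4 / 2))).congr_deriv ?_
    push_cast
    ring
  have hderiv2 (z : ℝ) : HasDerivAt
      (fun z => -exp (-z) / (1 + exp (-z)) - exp (-r) / 4 * z)
      (exp (-z) / (1 + exp (-z)) ^ 2 - exp (-r) / 4) z := by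
    simpa using (hasDerivAt_deriv_logistic z).fun_sub ((hasDerivAt_id z).const_mul (exp (-r) / 4))
  exact convexOn_of_hasDerivWithinAt2_nonneg (convex_Icc _ _)
    (fun z _ => (hderiv z).continuousAt.continuousWithinAt)
    (fun z _ => (hderiv z).hasDerivWithinAt) (fun z _ => (hderiv2 z).hasDerivWithinAt)
    fun z hz => sub_nonneg.2 (exp_neg_div_four_le_deriv2_logistic (interior_subset hz))

theorem logistic_strong_concavity_interpolation
    (B : ℝ) (hB : 0 < B) (σ : ℝ → ℝ) (hσ : ∀ z, σ z = Real.log (1 + Real.exp (-z)))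
    (η : ℝ) (hη : η ∈ Set.Ioo (0 : ℝ) 1)
    (p q : ℝ) (hp : p ∈ Set.Icc (-(2 * B)) (2 * B)) (hq : q ∈ Set.Icc (-(2 * B)) (2 * B)) :
    σ ((1 - η) * p + η * q) - (1 - η) * σ p - η * σ q ≤
      -(Real.exp (-(2 * B)) / 8) * (η * (1 - η)) * (q - p) ^ 2 := by
  have h := (strongConvexOn_logistic (2 * B)).2 hp hq (sub_nonneg.2 hη.2.le) hη.1.le
    (sub_add_cancel 1 η)
  simp only [smul_eq_mul, norm_eq_abs, sq_abs] at h
  rw [hσ, hσ, hσ]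
  linarith
end

section
/- For all u, v ∈ ℝ, letting p = 1/(1 + e^{-u}) and q = 1/(1 + e^{-v}), the Kullback–Leibler divergence between the Bernoulli distributions with success probabilities p and q satisfies p · log(p/q) + (1 - p) · log((1 - p)/(1 - q)) ≤ (u - v)²/8. -/
open Real

/-- A differentiable convex function lies above its tangent lines. -/
lemma ConvexOn.tangent_line_le {f : ℝ → ℝ} {f' x : ℝ} (hf : ConvexOn ℝ Set.univ f)
    (hx : HasDerivAt f f' x) (y : ℝ) : f x + f' * (y - x) ≤ f y := by
  rcases lt_trichotomy x y with h | rfl | h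
  · have := hf.le_slope_of_hasDerivAt (Set.mem_univ x) (Set.mem_univ y) h hx
    rw [slope_def_field, le_div_iff₀ (sub_pos.2 h)] at this
    linarith
  · simp
  · have := hf.slope_le_of_hasDerivAt (Set.mem_univ y) (Set.mem_univ x) h hx
    rw [slope_def_field, div_le_iff₀ (sub_pos.2 h)] at this
    linarith

lemma one_sub_sigmoid_pos (x : ℝ) : 0 < 1 - sigmoid x := sub_pos.2 (sigmoid_lt_one x)

lemma log_sigmoid (x : ℝ) : log (sigmoid x) = x + log (1 - sigmoid x) := by
  rw [← sigmoid_neg, ← sigmoid_mul_rexp_neg, log_mul (sigmoid_pos x).ne' (exp_pos _).ne', log_exp]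
  ring

lemma hasDerivAt_sq_div_eight_add_log_one_sub_sigmoid (x : ℝ) :
    HasDerivAt (fun y ↦ y ^ 2 / 8 + log (1 - sigmoid y)) (x / 4 - sigmoid x) x := by
  have hne := (one_sub_sigmoid_pos x).ne'
  refine (((hasDerivAt_pow 2 x).div_const 8).add
    (((hasDerivAt_sigmoid x).const_sub 1).log hne)).congr_deriv ?_
  rw [neg_div, mul_div_cancel_right₀ _ hne]
  norm_num
  ring

lemma monotone_div_four_sub_sigmoid : Monotone fun x : ℝ ↦ x / 4 - sigmoid x := by
  have h (x : ℝ) := ((hasDerivAt_id x).div_const 4).sub (hasDerivAt_sigmoid x)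
  refine monotone_of_hasDerivAt_nonneg h fun x ↦ ?_
  simp only [Pi.zero_apply]
  nlinarith [sq_nonneg (sigmoid x - 1 / 2)]

lemma convexOn_sq_div_eight_add_log_one_sub_sigmoid :
    ConvexOn ℝ Set.univ fun x : ℝ ↦ x ^ 2 / 8 + log (1 - sigmoid x) := by
  have h := hasDerivAt_sq_div_eight_add_log_one_sub_sigmoid
  refine Monotone.convexOn_univ_of_deriv (fun x ↦ (h x).differentiableAt) ?_
  rw [funext fun x ↦ (h x).deriv]
  exact monotone_div_four_sub_sigmoid

theorem bernoulli_kl_bound (u v : ℝ)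
    (p q : ℝ) (hp : p = 1 / (1 + Real.exp (-u))) (hq : q = 1 / (1 + Real.exp (-v))) :
    p * Real.log (p / q) + (1 - p) * Real.log ((1 - p) / (1 - q)) ≤ (u - v) ^ 2 / 8 := by
  rw [one_div, ← sigmoid_def] at hp hq
  subst hp hq
  rw [log_div (sigmoid_pos u).ne' (sigmoid_pos v).ne',
    log_div (one_sub_sigmoid_pos u).ne' (one_sub_sigmoid_pos v).ne', log_sigmoid u, log_sigmoid v]
  have := convexOn_sq_div_eight_add_log_one_sub_sigmoid.tangent_line_le
    (hasDerivAt_sq_div_eight_add_log_one_sub_sigmoid u) v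
  linarith
end

section
/- Let d ≥ 1 and let P be a probability distribution on ℝ^d × ℝ^d with bounded support. Then for every constant λ > 0, E_{(θ,φ)∼P}⟨θ, φ⟩ ≤ d·λ + (1/(4λ)) · E_{(θ,φ)∼P} E_{(θ',φ')∼P} ⟨θ', φ⟩², where (θ', φ') is an independent copy of (θ, φ) drawn from P. -/
open MeasureTheory RealInnerProductSpace

section SecondMoment

variable {Ω E : Type*} [MeasurableSpace Ω] {μ : Measure Ω}
  [NormedAddCommGroup E] [InnerProductSpace ℝ E]

/-- Cauchy-Schwarz combined with the arithmetic-geometric mean inequality, for real-valued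
square-integrable functions. -/
theorem integral_mul_le_add_integral_sq_mul {f g : Ω → ℝ} (hf : MemLp f 2 μ) (hg : MemLp g 2 μ)
    {c : ℝ} (hc : 0 < c) :
    ∫ ω, f ω * g ω ∂μ ≤ c + 1 / (4 * c) * ((∫ ω, f ω ^ 2 ∂μ) * ∫ ω, g ω ^ 2 ∂μ) := by
  have hfg : Integrable (fun ω => f ω * g ω) μ := hf.integrable_mul hg
  have hdisc : discrim (∫ ω, f ω ^ 2 ∂μ) (2 * ∫ ω, f ω * g ω ∂μ) (∫ ω, g ω ^ 2 ∂μ) ≤ 0 := by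
    refine discrim_le_zero fun t => ?_
    calc 0 ≤ ∫ ω, (t * f ω + g ω) ^ 2 ∂μ := integral_nonneg fun ω => sq_nonneg _
      _ = ∫ ω, (t * t * f ω ^ 2 + 2 * t * (f ω * g ω)) + g ω ^ 2 ∂μ := by
        congr 1 with ω; ring
      _ = _ := by
        have hsum : Integrable (fun ω => t * t * f ω ^ 2 + 2 * t * (f ω * g ω)) μ :=
          (hf.integrable_sq.const_mul _).add (hfg.const_mul _)
        rw [integral_add hsum hg.integrable_sq, integral_add (hf.integrable_sq.const_mul _) (hfg.const_mul _),
          integral_const_mul, integral_const_mul]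
        ring
  rw [discrim] at hdisc
  set I := ∫ ω, f ω * g ω ∂μ
  have hI : I ^ 2 ≤ (∫ ω, f ω ^ 2 ∂μ) * ∫ ω, g ω ^ 2 ∂μ := by linarith
  have hamgm : I ≤ c + 1 / (4 * c) * I ^ 2 := by
    have : c + 1 / (4 * c) * I ^ 2 - I = (2 * c - I) ^ 2 / (4 * c) := by field_simp; ring
    have : 0 ≤ (2 * c - I) ^ 2 / (4 * c) := by positivity
    linarith
  have : 1 / (4 * c) * I ^ 2 ≤ 1 / (4 * c) * ((∫ ω, f ω ^ 2 ∂μ) * ∫ ω, g ω ^ 2 ∂μ) := by gcongr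
  linarith

theorem MeasureTheory.MemLp.integrable_inner_smul {X : Ω → E} (hX : MemLp X 2 μ) (v : E) :
    Integrable (fun ω => ⟪X ω, v⟫ • X ω) μ :=
  memLp_one_iff_integrable.1 (hX.smul (hX.inner_const v))

/-- The uncentered second moment operator `v ↦ 𝔼[⟪X, v⟫ X]`. -/
noncomputable def secondMoment {X : Ω → E} (hX : MemLp X 2 μ) : E →ₗ[ℝ] E where
  toFun v := ∫ ω, ⟪X ω, v⟫ • X ω ∂μ
  map_add' u v := by
    simp only [inner_add_right, add_smul]
    exact integral_add (hX.integrable_inner_smul u) (hX.integrable_inner_smul v)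
  map_smul' c v := by
    simp only [inner_smul_right, mul_smul, RingHom.id_apply]
    exact integral_smul c _

theorem inner_secondMoment [CompleteSpace E] {X : Ω → E} (hX : MemLp X 2 μ) (u v : E) :
    ⟪u, secondMoment hX v⟫ = ∫ ω, ⟪X ω, v⟫ * ⟪X ω, u⟫ ∂μ := by
  change ⟪u, ∫ ω, ⟪X ω, v⟫ • X ω ∂μ⟫ = _
  rw [← integral_inner (hX.integrable_inner_smul v) u]
  simp only [inner_smul_right, real_inner_comm]

theorem secondMoment_isSymmetric [CompleteSpace E] {X : Ω → E} (hX : MemLp X 2 μ) :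
    (secondMoment hX).IsSymmetric := fun u v => by
  rw [real_inner_comm, inner_secondMoment, inner_secondMoment]
  simp only [mul_comm]

/-- There is an orthonormal basis in which the coordinates of `X` are uncorrelated. -/
theorem exists_orthonormalBasis_integral_inner_sq [FiniteDimensional ℝ E] {X : Ω → E}
    (hX : MemLp X 2 μ) :
    ∃ b : OrthonormalBasis (Fin (Module.finrank ℝ E)) ℝ E, ∀ v,
      ∫ ω, ⟪X ω, v⟫ ^ 2 ∂μ = ∑ i, (∫ ω, ⟪X ω, b i⟫ ^ 2 ∂μ) * ⟪b i, v⟫ ^ 2 := by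
  have : CompleteSpace E := FiniteDimensional.complete ℝ E
  have hT := secondMoment_isSymmetric hX
  have key (v : E) : ∫ ω, ⟪X ω, v⟫ ^ 2 ∂μ = ⟪v, secondMoment hX v⟫ := by
    simp only [inner_secondMoment, sq]
  refine ⟨hT.eigenvectorBasis rfl, fun v => ?_⟩
  rw [key, ← (hT.eigenvectorBasis rfl).sum_inner_mul_inner]
  refine Finset.sum_congr rfl fun i _ => ?_
  rw [key, ← hT, hT.apply_eigenvectorBasis, real_inner_comm]
  simp only [inner_smul_left, inner_smul_right, real_inner_self_eq_norm_sq,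
    OrthonormalBasis.norm_eq_one]
  simp
  ring

/-- The decoupling inequality for square-integrable random vectors. -/
theorem integral_inner_le_finrank_mul_add [FiniteDimensional ℝ E] {X Y : Ω → E}
    (hX : MemLp X 2 μ) (hY : MemLp Y 2 μ) {c : ℝ} (hc : 0 < c) :
    ∫ ω, ⟪X ω, Y ω⟫ ∂μ ≤
      Module.finrank ℝ E * c + 1 / (4 * c) * ∫ ω, ∫ ω', ⟪X ω', Y ω⟫ ^ 2 ∂μ ∂μ := by
  obtain ⟨b, hb⟩ := exists_orthonormalBasis_integral_inner_sq hX
  have hXb i : MemLp (fun ω => ⟪X ω, b i⟫) 2 μ := hX.inner_const (b i)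
  have hYb i : MemLp (fun ω => ⟪b i, Y ω⟫) 2 μ := hY.const_inner (b i)
  have hXY : ∫ ω, ⟪X ω, Y ω⟫ ∂μ = ∑ i, ∫ ω, ⟪X ω, b i⟫ * ⟪b i, Y ω⟫ ∂μ := by
    have hint i : Integrable (fun ω => ⟪X ω, b i⟫ * ⟪b i, Y ω⟫) μ :=
      (hXb i).integrable_mul (hYb i)
    rw [← integral_finsetSum _ fun i _ => hint i]
    exact integral_congr_ae (.of_forall fun ω => (b.sum_inner_mul_inner (X ω) (Y ω)).symm)
  have hsq : ∫ ω, ∫ ω', ⟪X ω', Y ω⟫ ^ 2 ∂μ ∂μ =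
      ∑ i, (∫ ω, ⟪X ω, b i⟫ ^ 2 ∂μ) * ∫ ω, ⟪b i, Y ω⟫ ^ 2 ∂μ := by
    rw [integral_congr_ae (.of_forall fun ω => hb (Y ω)),
      integral_finsetSum _ fun i _ => (hYb i).integrable_sq.const_mul _]
    simp only [integral_const_mul]
  rw [hXY, hsq]
  refine (Finset.sum_le_sum fun i _ =>
    integral_mul_le_add_integral_sq_mul (hXb i) (hYb i) hc).trans_eq ?_
  simp [Finset.sum_add_distrib, Finset.mul_sum]

end SecondMoment

theorem decoupling_lemma
    (d : ℕ) (hd : 1 ≤ d)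
    (P : Measure (EuclideanSpace ℝ (Fin d) × EuclideanSpace ℝ (Fin d)))
    [IsProbabilityMeasure P]
    (hbdd : ∃ C : ℝ, ∀ᵐ x ∂P, ‖x.1‖ ≤ C ∧ ‖x.2‖ ≤ C)
    (lam : ℝ) (hlam : 0 < lam) :
    (∫ x, ⟪x.1, x.2⟫ ∂P) ≤
      d * lam + (1 / (4 * lam)) * ∫ x, ∫ y, ⟪y.1, x.2⟫ ^ 2 ∂P ∂P := by
  obtain ⟨C, hC⟩ := hbdd
  have hfst : MemLp Prod.fst 2 P :=
    .of_bound measurable_fst.aestronglyMeasurable C (hC.mono fun _ h => h.1)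
  have hsnd : MemLp Prod.snd 2 P :=
    .of_bound measurable_snd.aestronglyMeasurable C (hC.mono fun _ h => h.2)
  simpa using integral_inner_le_finrank_mul_add hfst hsnd hlam
end

section
/- Let σ(z) = log(1 + exp(-z)). For all u, v ∈ ℝ and every η > 0, the following identity holds: (1/(1 + e^{-u})) · ((1 + e^{-u})/(1 + e^{-v}))^{η} + (1/(1 + e^{u})) · ((1 + e^{u})/(1 + e^{v}))^{η} = exp( σ((1-η)u + ηv) - (1-η)σ(u) - ησ(v) ). -/
open Real

theorem one_add_exp_neg_eq_exp_log (z : ℝ) :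
    1 + Real.exp (-z) = Real.exp (Real.log (1 + Real.exp (-z))) :=
  (Real.exp_log (by positivity)).symm

theorem one_add_exp_eq_exp_log_add (z : ℝ) :
    1 + Real.exp z = Real.exp (Real.log (1 + Real.exp (-z)) + z) := by
  rw [Real.exp_add, ← one_add_exp_neg_eq_exp_log, add_mul, ← Real.exp_add, neg_add_cancel,
    Real.exp_zero, one_mul, add_comm]

theorem one_div_exp_mul_div_rpow (a b η : ℝ) :
    1 / Real.exp a * (Real.exp a / Real.exp b) ^ η = Real.exp (-a + η * (a - b)) := by
  rw [← Real.exp_sub, ← Real.exp_mul, one_div, ← Real.exp_neg, ← Real.exp_add, mul_comm η]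

theorem exponential_moment_identity
    (σ : ℝ → ℝ) (hσ : ∀ z, σ z = Real.log (1 + Real.exp (-z)))
    (u v η : ℝ) (hη : 0 < η) :
    (1 / (1 + Real.exp (-u))) * ((1 + Real.exp (-u)) / (1 + Real.exp (-v))) ^ η +
      (1 / (1 + Real.exp u)) * ((1 + Real.exp u) / (1 + Real.exp v)) ^ η =
      Real.exp (σ ((1 - η) * u + η * v) - (1 - η) * σ u - η * σ v) := by
  have hneg (z : ℝ) : 1 + Real.exp (-z) = Real.exp (σ z) := by
    rw [hσ]; exact one_add_exp_neg_eq_exp_log z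
  have hpos (z : ℝ) : 1 + Real.exp z = Real.exp (σ z + z) := by
    rw [hσ]; exact one_add_exp_eq_exp_log_add z
  rw [hneg u, hneg v, hpos u, hpos v, one_div_exp_mul_div_rpow, one_div_exp_mul_div_rpow,
    sub_sub, Real.exp_sub, ← hneg, div_eq_mul_inv, ← Real.exp_neg, add_mul, one_mul,
    ← Real.exp_add]
  congr 2 <;> ring
end

section
/- Let B > 0, let σ(z) = log(1 + exp(-z)), and let 0 < η ≤ 1/2. For all u, v ∈ [-2B, 2B], (1/(1 + e^{-u})) · ((1 + e^{-u})/(1 + e^{-v}))^{η} + (1/(1 + e^{u})) · ((1 + e^{u})/(1 + e^{v}))^{η} ≤ exp( -(e^{-2B}/16) · η · (u - v)² ). -/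
open Real

/-- Jensen's inequality for `x ↦ x ^ θ` at two points, written for square roots. -/
theorem add_rpow_le_sqrt_add_sqrt_rpow {p q x y η : ℝ} (hp : 0 ≤ p) (hq : 0 ≤ q)
    (hpq : p + q = 1) (hx : 0 ≤ x) (hy : 0 ≤ y) (hη0 : 0 ≤ η) (hη : η ≤ 1 / 2) :
    p * x ^ η + q * y ^ η ≤ (p * √x + q * √y) ^ (2 * η) := by
  have sqrt_rpow : ∀ z : ℝ, 0 ≤ z → √z ^ (2 * η) = z ^ η := fun z hz => by
    rw [sqrt_eq_rpow, ← rpow_mul hz]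
    ring_nf
  have h := (concaveOn_rpow (p := 2 * η) (by linarith) (by linarith)).2
    (Set.mem_Ici.2 (sqrt_nonneg x)) (Set.mem_Ici.2 (sqrt_nonneg y)) hp hq hpq
  simpa only [smul_eq_mul, sqrt_rpow x hx, sqrt_rpow y hy] using h

theorem one_add_sq_div_two_le_cosh (x : ℝ) : 1 + x ^ 2 / 2 ≤ cosh x := by
  have hsinh : |x / 2| ≤ |sinh (x / 2)| := by
    rw [abs_sinh]
    exact self_le_sinh_iff.2 (abs_nonneg _)
  have hcosh := cosh_two_mul (x / 2)
  rw [mul_div_cancel₀ x two_ne_zero, cosh_sq] at hcosh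
  linarith [sq_le_sq.2 hsinh]

/-- The squared Bhattacharyya coefficient of two Bernoulli laws with log-odds `2 * s`, `2 * t`. -/
theorem sq_bhattacharyya_le {B s t : ℝ} (hs : |s| ≤ B) (ht : |t| ≤ B) :
    (exp s * exp t + 1) ^ 2 / ((1 + exp s ^ 2) * (1 + exp t ^ 2)) ≤
      exp (-(exp (-(2 * B)) / 4 * (s - t) ^ 2)) := by
  have hcosh : ∀ x : ℝ, |x| ≤ 2 * B → cosh x ≤ exp (2 * B) := fun x hx => by
    have h1 := exp_le_exp.2 (abs_le.1 hx).2
    have h2 : exp (-x) ≤ exp (2 * B) := exp_le_exp.2 (by linarith [(abs_le.1 hx).1])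
    rw [cosh_eq]
    linarith
  have hm := hcosh (s + t) ((abs_add_le s t).trans (by linarith))
  have hd := hcosh (s - t) ((abs_sub s t).trans (by linarith))
  have hquad : (s - t) ^ 2 / 2 ≤ cosh (s - t) - 1 := by
    linarith [one_add_sq_div_two_le_cosh (s - t)]
  have hpos : 0 < cosh (s + t) + cosh (s - t) := add_pos (cosh_pos _) (cosh_pos _)
  have heq : (exp s * exp t + 1) ^ 2 / ((1 + exp s ^ 2) * (1 + exp t ^ 2)) =
      1 - (cosh (s - t) - 1) / (cosh (s + t) + cosh (s - t)) := by
    have hs0 := exp_pos s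
    have ht0 := exp_pos t
    rw [one_sub_div hpos.ne', div_eq_div_iff (by positivity) hpos.ne']
    simp only [cosh_eq, neg_add, neg_sub, exp_add, exp_sub, exp_neg]
    field_simp
    ring
  have hle : exp (-(2 * B)) / 4 * (s - t) ^ 2 ≤
      (cosh (s - t) - 1) / (cosh (s + t) + cosh (s - t)) := by
    calc exp (-(2 * B)) / 4 * (s - t) ^ 2 = ((s - t) ^ 2 / 2) / (2 * exp (2 * B)) := by
          rw [exp_neg]
          field_simp
          norm_num
      _ ≤ _ := div_le_div₀ ((by positivity : 0 ≤ (s - t) ^ 2 / 2).trans hquad) hquad hpos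
          (by linarith)
  rw [heq]
  exact (one_sub_le_exp_neg _).trans (exp_le_exp.2 (neg_le_neg hle))

theorem sqrt_sum_eq_bhattacharyya {a b : ℝ} (ha : 0 < a) (hb : 0 < b) :
    (1 / (1 + (a ^ 2)⁻¹)) * √((1 + (a ^ 2)⁻¹) / (1 + (b ^ 2)⁻¹)) +
      (1 / (1 + a ^ 2)) * √((1 + a ^ 2) / (1 + b ^ 2)) =
      √((a * b + 1) ^ 2 / ((1 + a ^ 2) * (1 + b ^ 2))) := by
  have hx : (1 + (a ^ 2)⁻¹) / (1 + (b ^ 2)⁻¹) =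
      (b / a) ^ 2 * ((1 + a ^ 2) / (1 + b ^ 2)) := by
    field_simp
    ring
  have hz : (a * b + 1) ^ 2 / ((1 + a ^ 2) * (1 + b ^ 2)) =
      ((a * b + 1) / (1 + a ^ 2)) ^ 2 * ((1 + a ^ 2) / (1 + b ^ 2)) := by
    field_simp
  rw [hx, hz, sqrt_mul (sq_nonneg _), sqrt_mul (sq_nonneg _), sqrt_sq (by positivity),
    sqrt_sq (by positivity)]
  field_simp
  ring

theorem exponential_moment_bound
    (B : ℝ) (hB : 0 < B) (σ : ℝ → ℝ) (hσ : ∀ z, σ z = Real.log (1 + Real.exp (-z)))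
    (η : ℝ) (hη0 : 0 < η) (hη : η ≤ 1 / 2)
    (u v : ℝ) (hu : u ∈ Set.Icc (-(2 * B)) (2 * B)) (hv : v ∈ Set.Icc (-(2 * B)) (2 * B)) :
    (1 / (1 + Real.exp (-u))) * ((1 + Real.exp (-u)) / (1 + Real.exp (-v))) ^ η +
      (1 / (1 + Real.exp u)) * ((1 + Real.exp u) / (1 + Real.exp v)) ^ η ≤
      Real.exp (-(Real.exp (-(2 * B)) / 16) * η * (u - v) ^ 2) := by
  have hsum : 1 / (1 + exp (-u)) + 1 / (1 + exp u) = 1 := by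
    have := exp_pos u
    rw [exp_neg]
    field_simp
    ring
  refine (add_rpow_le_sqrt_add_sqrt_rpow (by positivity) (by positivity) hsum (by positivity)
    (by positivity) hη0.le hη).trans ?_
  have hexp : ∀ x : ℝ, exp x = exp (x / 2) ^ 2 := fun x => by
    rw [← exp_nat_mul]
    push_cast
    ring_nf
  rw [exp_neg u, exp_neg v, hexp u, hexp v, sqrt_sum_eq_bhattacharyya (exp_pos _) (exp_pos _),
    sqrt_eq_rpow, ← rpow_mul (by positivity)]
  have hbound := sq_bhattacharyya_le (B := B) (s := u / 2) (t := v / 2)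
    (abs_le.2 ⟨by linarith [hu.1], by linarith [hu.2]⟩)
    (abs_le.2 ⟨by linarith [hv.1], by linarith [hv.2]⟩)
  refine (rpow_le_rpow (by positivity) hbound (by positivity)).trans_eq ?_
  rw [← exp_mul]
  ring_nf
end

section
/- Let d ≥ 1, let Φ be a nonempty finite subset of ℝ^d, and let θ¹, θ², θ* ∈ ℝ^d. Let φ¹ ∈ Φ maximize ⟨θ¹, ·⟩ over Φ, let φ² ∈ Φ maximize ⟨θ², ·⟩ over Φ, and let φ* ∈ Φ maximize ⟨θ*, ·⟩ over Φ. Define BE¹ = ⟨θ¹ - θ*, φ¹ - φ²⟩, BE² = ⟨θ² - θ*, φ² - φ¹⟩, FG¹ = max_{φ∈Φ}⟨θ¹, φ - φ²⟩ - ⟨θ*, φ* - φ²⟩, and FG² = max_{φ∈Φ}⟨θ², φ - φ¹⟩ - ⟨θ*, φ* - φ¹⟩. Then ⟨θ*, φ*⟩ - (⟨θ*, φ¹⟩ + ⟨θ*, φ²⟩)/2 = (1/2)(BE¹ + BE² - FG¹ - FG²). -/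
open RealInnerProductSpace

theorem sup'_inner_sub_eq {E : Type*} [NormedAddCommGroup E] [InnerProductSpace ℝ E]
    {Φ : Finset E} (hΦ : Φ.Nonempty) {θ φ₀ : E} (ψ : E) (hφ₀ : φ₀ ∈ Φ)
    (hmax : ∀ φ ∈ Φ, ⟪θ, φ⟫ ≤ ⟪θ, φ₀⟫) :
    Φ.sup' hΦ (fun φ => ⟪θ, φ - ψ⟫) = ⟪θ, φ₀ - ψ⟫ := by
  refine le_antisymm (Finset.sup'_le _ _ fun φ hφ => ?_)
    (Finset.le_sup' (fun φ => ⟪θ, φ - ψ⟫) hφ₀)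
  simpa only [inner_sub_right, sub_le_sub_iff_right] using hmax φ hφ

theorem regret_decomposition
    (d : ℕ) (hd : 1 ≤ d)
    (Φ : Finset (EuclideanSpace ℝ (Fin d))) (hΦ : Φ.Nonempty)
    (θ1 θ2 θs φ1 φ2 φs : EuclideanSpace ℝ (Fin d))
    (hφ1 : φ1 ∈ Φ) (hmax1 : ∀ φ ∈ Φ, ⟪θ1, φ⟫ ≤ ⟪θ1, φ1⟫)
    (hφ2 : φ2 ∈ Φ) (hmax2 : ∀ φ ∈ Φ, ⟪θ2, φ⟫ ≤ ⟪θ2, φ2⟫)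
    (hφs : φs ∈ Φ) (hmaxs : ∀ φ ∈ Φ, ⟪θs, φ⟫ ≤ ⟪θs, φs⟫)
    (BE1 BE2 FG1 FG2 : ℝ)
    (hBE1 : BE1 = ⟪θ1 - θs, φ1 - φ2⟫)
    (hBE2 : BE2 = ⟪θ2 - θs, φ2 - φ1⟫)
    (hFG1 : FG1 = Φ.sup' hΦ (fun φ => ⟪θ1, φ - φ2⟫) - ⟪θs, φs - φ2⟫)
    (hFG2 : FG2 = Φ.sup' hΦ (fun φ => ⟪θ2, φ - φ1⟫) - ⟪θs, φs - φ1⟫) :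
    ⟪θs, φs⟫ - (⟪θs, φ1⟫ + ⟪θs, φ2⟫) / 2 = (1 / 2) * (BE1 + BE2 - FG1 - FG2) := by
  rw [hBE1, hBE2, hFG1, hFG2, sup'_inner_sub_eq hΦ φ2 hφ1 hmax1,
    sup'_inner_sub_eq hΦ φ1 hφ2 hmax2]
  simp only [inner_sub_left, inner_sub_right]
  ring
end

section
/- Let B > 0 and 0 < η ≤ 1/2, and let X be a random variable on a probability space satisfying 0 ≤ X ≤ 16B² almost surely. Then log E[ exp( -(η e^{-2B}/8) · X ) ] ≤ -(η e^{-2B}/9) · E[X]. -/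
open MeasureTheory Real

theorem exp_neg_le_one_sub_mul {y : ℝ} (h0 : 0 ≤ y) (h1 : y ≤ 1 / 5) :
    Real.exp (-y) ≤ 1 - 8 / 9 * y := by
  have hq := Real.quadratic_le_exp_of_nonneg h0
  rw [Real.exp_neg, inv_le_iff_one_le_mul₀ (Real.exp_pos y)]
  calc (1 : ℝ) ≤ (1 - 8 / 9 * y) * (1 + y + y ^ 2 / 2) := by
        have hfactor : 0 ≤ y * (1 / 9 - 7 / 18 * y - 4 / 9 * y ^ 2) :=
          mul_nonneg h0 (by nlinarith)
        linarith
    _ ≤ (1 - 8 / 9 * y) * Real.exp y := by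
        gcongr
        linarith

theorem sq_mul_exp_neg_two_mul_le {B : ℝ} (hB : 0 ≤ B) :
    B ^ 2 * Real.exp (-(2 * B)) ≤ 1 / 5 := by
  have h1 : B * Real.exp (-B) ≤ 2 / 5 := by
    have h := Real.add_one_le_exp (B - 1)
    rw [Real.exp_sub, sub_add_cancel, le_div_iff₀ (Real.exp_pos 1)] at h
    rw [Real.exp_neg, ← div_eq_mul_inv, div_le_iff₀ (Real.exp_pos B)]
    nlinarith [Real.exp_one_gt_d9]
  have h2 : B ^ 2 * Real.exp (-(2 * B)) = (B * Real.exp (-B)) ^ 2 := by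
    rw [mul_pow, ← Real.exp_nat_mul]
    push_cast
    ring_nf
  have h3 : 0 ≤ B * Real.exp (-B) := by positivity
  rw [h2]
  nlinarith

theorem log_mgf_linearization
    {Ω : Type*} [MeasurableSpace Ω] (μ : Measure Ω) [IsProbabilityMeasure μ]
    (B : ℝ) (hB : 0 < B) (η : ℝ) (hη0 : 0 < η) (hη : η ≤ 1 / 2)
    (X : Ω → ℝ) (hXmeas : Measurable X)
    (hX : ∀ᵐ ω ∂μ, 0 ≤ X ω ∧ X ω ≤ 16 * B ^ 2) :
    Real.log (∫ ω, Real.exp (-(η * Real.exp (-(2 * B)) / 8) * X ω) ∂μ) ≤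
      -(η * Real.exp (-(2 * B)) / 9) * ∫ ω, X ω ∂μ := by
  have hE := sq_mul_exp_neg_two_mul_le hB.le
  set c := η * Real.exp (-(2 * B)) / 8 with hc
  have hc0 : 0 ≤ c := by positivity
  have hcB : c * (16 * B ^ 2) ≤ 1 / 5 := by
    have : 0 ≤ B ^ 2 * Real.exp (-(2 * B)) := by positivity
    rw [hc]
    nlinarith
  have hXint : Integrable X μ := by
    refine Integrable.of_bound hXmeas.aestronglyMeasurable (16 * B ^ 2) ?_
    filter_upwards [hX] with ω hω
    rw [Real.norm_of_nonneg hω.1]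
    exact hω.2
  have hexpint : Integrable (fun ω => Real.exp (-c * X ω)) μ := by
    refine Integrable.of_bound (by fun_prop) 1 ?_
    filter_upwards [hX] with ω hω
    rw [Real.norm_of_nonneg (Real.exp_pos _).le, Real.exp_le_one_iff]
    nlinarith [mul_nonneg hc0 hω.1]
  have hle : ∫ ω, Real.exp (-c * X ω) ∂μ ≤ ∫ ω, (1 - 8 / 9 * c * X ω) ∂μ := by
    refine integral_mono_ae hexpint ((integrable_const 1).sub (hXint.const_mul _)) ?_
    filter_upwards [hX] with ω hω
    have h := exp_neg_le_one_sub_mul (mul_nonneg hc0 hω.1)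
      ((mul_le_mul_of_nonneg_left hω.2 hc0).trans hcB)
    rwa [← neg_mul, ← mul_assoc] at h
  rw [integral_sub (integrable_const 1) (hXint.const_mul _), integral_const_mul] at hle
  simp only [integral_const, probReal_univ, smul_eq_mul, mul_one] at hle
  have hlog := Real.log_le_sub_one_of_pos (integral_exp_pos hexpint)
  have hcoef : η * Real.exp (-(2 * B)) / 9 = 8 / 9 * c := by
    rw [hc]
    ring
  rw [hcoef]
  linarith
end
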